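/- Let B ∈ ℂ^{M×M} be a Hermitian positive semidefinite matrix, let σ² > 0 and κ ∈ [0,1). Then log₂ det(I_M + (1/σ²)·B) − log₂ det(I_M + ((1−κ)/σ²)·B) ≤ rank(B) · log₂(1/(1−κ)). -/

import Mathlib

open scoped ComplexOrder

/-- The determinant of `1 + c • A`, for Hermitian `A`, in terms of the eigenvalues of `A`. -/
theorem Matrix.IsHermitian.det_one_add_smul {n : Type*} [Fintype n] [DecidableEq n]
    {A : Matrix n n ℂ} (hA : A.IsHermitian) (c : ℝ) :
    (1 + (c : ℂ) • A).det = ((∏ i, (1 + c * hA.eigenvalues i) : ℝ) : ℂ) := by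
  have hU : (hA.eigenvectorUnitary : Matrix n n ℂ) * star (hA.eigenvectorUnitary : Matrix n n ℂ)
      = 1 := Unitary.coe_mul_star_self _
  have h : 1 + (c : ℂ) • A = (hA.eigenvectorUnitary : Matrix n n ℂ) *
      Matrix.diagonal (fun i => ((1 + c * hA.eigenvalues i : ℝ) : ℂ)) *
      star (hA.eigenvectorUnitary : Matrix n n ℂ) := by
    have hd : Matrix.diagonal (fun i => ((1 + c * hA.eigenvalues i : ℝ) : ℂ)) =
        1 + (c : ℂ) • Matrix.diagonal (RCLike.ofReal ∘ hA.eigenvalues) := by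
      ext i j
      by_cases hij : i = j
      · subst hij; simp
      · simp [hij]
    conv_lhs => rw [hA.spectral_theorem, Unitary.conjStarAlgAut_apply]
    rw [hd, mul_add, add_mul, mul_one, hU, Matrix.mul_smul, Matrix.smul_mul]
  rw [h, Matrix.det_mul, Matrix.det_mul, mul_right_comm, ← Matrix.det_mul, hU, Matrix.det_one,
    one_mul, Matrix.det_diagonal, Complex.ofReal_prod]

/-- A factor-by-factor bound: rescaling by `t ∈ (0, 1]` loses at most `log₂ (1 / t)`. -/
theorem Real.logb_one_add_sub_logb_one_add_mul_le {t x : ℝ} (ht : 0 < t) (ht1 : t ≤ 1)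
    (hx : 0 ≤ x) :
    Real.logb 2 (1 + x) - Real.logb 2 (1 + t * x) ≤ Real.logb 2 (1 / t) := by
  have htx : 0 ≤ t * x := by positivity
  rw [← Real.logb_div (by positivity) (by positivity)]
  refine Real.logb_le_logb_of_le one_lt_two (by positivity) ?_
  rw [div_le_div_iff₀ (by positivity) ht]
  nlinarith

/-- Finite-SNR ceiling: for Hermitian positive semidefinite `B ∈ ℂ^{M×M}`, `σ² > 0`
and `κ ∈ [0,1)`,
`log₂ det(I + (1/σ²)B) − log₂ det(I + ((1−κ)/σ²)B) ≤ rank(B)·log₂(1/(1−κ))`. -/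
theorem stmt_15 (M : ℕ) (B : Matrix (Fin M) (Fin M) ℂ) (hB : B.PosSemidef)
    (σ2 κ : ℝ) (hσ : 0 < σ2) (hκ : κ ∈ Set.Ico (0:ℝ) 1) :
    Real.logb 2 ((1 + ((1 / σ2 : ℝ) : ℂ) • B).det.re) -
        Real.logb 2 ((1 + (((1 - κ) / σ2 : ℝ) : ℂ) • B).det.re) ≤
      B.rank * Real.logb 2 (1 / (1 - κ)) := by
  obtain ⟨hκ0, hκ1⟩ := hκ
  set ev := hB.isHermitian.eigenvalues
  have hnn : ∀ i, 0 ≤ ev i := hB.eigenvalues_nonneg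
  have ht : 0 < 1 - κ := sub_pos.2 hκ1
  have hlog : ∀ c : ℝ, 0 ≤ c →
      Real.logb 2 ((1 + (c : ℂ) • B).det.re) = ∑ i, Real.logb 2 (1 + c * ev i) := by
    intro c hc
    rw [hB.isHermitian.det_one_add_smul, Complex.ofReal_re, Real.logb_prod]
    intro i _
    have := mul_nonneg hc (hnn i)
    positivity
  rw [hlog _ (by positivity), hlog _ (by positivity), ← Finset.sum_sub_distrib,
    hB.isHermitian.rank_eq_card_non_zero_eigs, Fintype.card_subtype, ← nsmul_eq_mul,
    ← Finset.sum_const, Finset.sum_filter]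
  refine Finset.sum_le_sum fun i _ => ?_
  split_ifs with hi
  · have h := Real.logb_one_add_sub_logb_one_add_mul_le ht (sub_le_self 1 hκ0)
      (mul_nonneg (one_div_pos.2 hσ).le (hnn i))
    rwa [← mul_assoc, mul_one_div] at h
  · have h0 : ev i = 0 := not_not.1 hi
    simp [h0]
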